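/- For every n ≥ 1, let the symmetric group Σ_n = Perm(Fin n) act on uD_ℝ(n) × Σ_n, on uD^c(n) × Σ_n, and on Σ_n by left multiplication on the Σ_n factor (and trivially on the uD factors), where Σ_n carries the discrete topology. Then the inclusion uD_ℝ(n) × Σ_n ↪ uD^c(n) × Σ_n and the map Σ_n → uD^c(n) × Σ_n sending σ to (((0,0), …, (0,0)), σ) are Σ_n-equivariant homotopy equivalences: each admits a continuous Σ_n-equivariant homotopy inverse, with homotopies all of whose time-slices are Σ_n-equivariant. -/

import Mathlib

open Set

/-- The (finite) symmetric group carries the discrete topology. -/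
instance (n : ℕ) : TopologicalSpace (Equiv.Perm (Fin n)) := ⊥

/-- The ordered part `uD_ℝ(n)` of the one-dimensional little disks operad. -/
def uDR (n : ℕ) : Set (Fin n → ℝ × ℝ) :=
  {x | (∀ j, 0 < (x j).2 ∧ |(x j).1| + (x j).2 ≤ 1) ∧
    ∀ j : Fin n, ∀ h : (j : ℕ) + 1 < n,
      (x j).1 + (x j).2 ≤ (x ⟨(j : ℕ) + 1, h⟩).1 - (x ⟨(j : ℕ) + 1, h⟩).2}

/-- The ordered part `uD^c(n)` of the extended one-dimensional little disks operad. -/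
def uDc (n : ℕ) : Set (Fin n → ℝ × ℝ) :=
  {x | (∀ j, 0 ≤ (x j).2 ∧ |(x j).1| + (x j).2 ≤ 1) ∧
    ∀ j : Fin n, ∀ h : (j : ℕ) + 1 < n,
      (x j).1 ≤ (x ⟨(j : ℕ) + 1, h⟩).1 ∧
      ((x j).1 + (x j).2 ≤ (x ⟨(j : ℕ) + 1, h⟩).1 - (x ⟨(j : ℕ) + 1, h⟩).2 ∨
        ((x j).2 = 0 ∧ (x ⟨(j : ℕ) + 1, h⟩).2 = 0))}

/-- Ambient space modeling `uD(n) × Σ_n`. -/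
abbrev AD (n : ℕ) : Type := (Fin n → ℝ × ℝ) × Equiv.Perm (Fin n)

/-- `uD_ℝ(n) × Σ_n` inside the ambient space. -/
def ADR (n : ℕ) : Set (AD n) := (uDR n) ×ˢ (univ : Set (Equiv.Perm (Fin n)))

/-- `uD^c(n) × Σ_n` inside the ambient space. -/
def ADc (n : ℕ) : Set (AD n) := (uDc n) ×ˢ (univ : Set (Equiv.Perm (Fin n)))

/-- The `Σ_n`-action by left multiplication on the `Σ_n` factor. -/
def permActAD (n : ℕ) (ρ : Equiv.Perm (Fin n)) (y : AD n) : AD n := (y.1, ρ * y.2)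

/-- The base point inclusion `Σ_n → uD^c(n) × Σ_n`, `σ ↦ (((0,0), …, (0,0)), σ)`. -/
def ptMap (n : ℕ) (σ : Equiv.Perm (Fin n)) : AD n := (fun _ => ((0 : ℝ), (0 : ℝ)), σ)

theorem mem_uDc_iff {n : ℕ} {x : Fin n → ℝ × ℝ} :
    x ∈ uDc n ↔ (∀ j, 0 ≤ (x j).2 ∧ |(x j).1| + (x j).2 ≤ 1) ∧
      ∀ j : Fin n, ∀ h : (j : ℕ) + 1 < n,
        (x j).1 + (x j).2 ≤ (x ⟨(j : ℕ) + 1, h⟩).1 - (x ⟨(j : ℕ) + 1, h⟩).2 := by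
  refine and_congr_right fun hx => forall₂_congr fun j h => ?_
  have h₁ := (hx j).1
  have h₂ := (hx ⟨(j : ℕ) + 1, h⟩).1
  constructor
  · rintro ⟨hle, hsep | ⟨h₃, h₄⟩⟩ <;> linarith
  · exact fun hsep => ⟨by linarith, Or.inl hsep⟩

theorem mem_uDR_iff {n : ℕ} {x : Fin n → ℝ × ℝ} :
    x ∈ uDR n ↔ x ∈ uDc n ∧ ∀ j, 0 < (x j).2 := by
  rw [mem_uDc_iff]
  constructor
  · exact fun h => ⟨⟨fun j => ⟨(h.1 j).1.le, (h.1 j).2⟩, h.2⟩, fun j => (h.1 j).1⟩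
  · exact fun h => ⟨fun j => ⟨h.2 j, (h.1.1 j).2⟩, h.1.2⟩

theorem uDR_subset_uDc (n : ℕ) : uDR n ⊆ uDc n := fun _ hx => (mem_uDR_iff.1 hx).1

theorem convex_uDc (n : ℕ) : Convex ℝ (uDc n) := by
  intro x hx y hy a b ha hb hab
  rw [mem_uDc_iff] at hx hy ⊢
  refine ⟨fun j => ?_, fun j h => ?_⟩
  · obtain ⟨hx₀, hx₁⟩ := hx.1 j
    obtain ⟨hy₀, hy₁⟩ := hy.1 j
    have habs : |a * (x j).1 + b * (y j).1| ≤ a * |(x j).1| + b * |(y j).1| := by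
      simpa [abs_mul, abs_of_nonneg ha, abs_of_nonneg hb] using
        abs_add_le (a * (x j).1) (b * (y j).1)
    simp only [Pi.add_apply, Pi.smul_apply, Prod.fst_add, Prod.snd_add, Prod.smul_fst,
      Prod.smul_snd, smul_eq_mul]
    refine ⟨by positivity, ?_⟩
    linarith [mul_le_mul_of_nonneg_left hx₁ ha, mul_le_mul_of_nonneg_left hy₁ hb]
  · simp only [Pi.add_apply, Pi.smul_apply, Prod.fst_add, Prod.snd_add, Prod.smul_fst,
      Prod.smul_snd, smul_eq_mul]
    linarith [mul_le_mul_of_nonneg_left (hx.2 j h) ha, mul_le_mul_of_nonneg_left (hy.2 j h) hb]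

theorem convex_uDR (n : ℕ) : Convex ℝ (uDR n) := by
  intro x hx y hy a b ha hb hab
  rw [mem_uDR_iff] at hx hy ⊢
  exact ⟨convex_uDc n hx.1 hy.1 ha hb hab,
    fun j => convex_Ioi (0 : ℝ) (hx.2 j) (hy.2 j) ha hb hab⟩

/-- The configuration of `n` equal intervals subdividing `[-1, 1]`. -/
noncomputable def equalSubdivision (n : ℕ) : Fin n → ℝ × ℝ :=
  fun j => ((2 * (j : ℝ) + 1) / n - 1, 1 / n)

theorem equalSubdivision_mem_uDR (n : ℕ) : equalSubdivision n ∈ uDR n := by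
  refine ⟨fun j => ?_, fun j h => ?_⟩
  · have hn : (0 : ℝ) < n := Nat.cast_pos.2 j.pos
    have hj : (j : ℝ) + 1 ≤ n := by exact_mod_cast j.isLt
    refine ⟨one_div_pos.2 hn, ?_⟩
    have hlower : 0 ≤ 2 * (j : ℝ) / n := by positivity
    have hupper : (2 * (j : ℝ) + 2) / n ≤ 2 := by
      rw [div_le_iff₀ hn]
      linarith
    have hcenter : (2 * (j : ℝ) + 1) / n = 2 * (j : ℝ) / n + 1 / n := add_div _ _ _
    have hright : (2 * (j : ℝ) + 2) / n = 2 * (j : ℝ) / n + 1 / n + 1 / n := by ring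
    rw [← le_sub_iff_add_le, abs_le]
    simp only [equalSubdivision]
    constructor <;> linarith
  · simp only [equalSubdivision]
    push_cast
    apply le_of_eq
    ring

theorem zero_mem_uDc (n : ℕ) : (0 : Fin n → ℝ × ℝ) ∈ uDc n := by
  simp [mem_uDc_iff]

/-- The straight-line homotopy from the constant configuration `c` to the identity,
leaving the permutation fixed. -/
def lineHomotopy {n : ℕ} (c : Fin n → ℝ × ℝ) (p : AD n × ℝ) : AD n :=
  ((1 - p.2) • c + p.2 • p.1.1, p.1.2)

section lineHomotopy

variable {n : ℕ} (c : Fin n → ℝ × ℝ)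

theorem continuous_lineHomotopy : Continuous (lineHomotopy c) := by
  unfold lineHomotopy
  fun_prop

theorem lineHomotopy_zero (y : AD n) : lineHomotopy c (y, 0) = (c, y.2) := by
  simp [lineHomotopy]

theorem lineHomotopy_one (y : AD n) : lineHomotopy c (y, 1) = y := by
  simp [lineHomotopy]

theorem lineHomotopy_permActAD (ρ : Equiv.Perm (Fin n)) (y : AD n) (t : ℝ) :
    lineHomotopy c (permActAD n ρ y, t) = permActAD n ρ (lineHomotopy c (y, t)) := rfl

variable {c}

theorem lineHomotopy_mem {s : Set (Fin n → ℝ × ℝ)} (hs : Convex ℝ s) (hc : c ∈ s) {y : AD n}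
    (hy : y ∈ s ×ˢ (univ : Set (Equiv.Perm (Fin n)))) {t : ℝ} (ht : t ∈ Icc (0 : ℝ) 1) :
    lineHomotopy c (y, t) ∈ s ×ˢ (univ : Set (Equiv.Perm (Fin n))) :=
  ⟨hs hc hy.1 (sub_nonneg.2 ht.2) ht.1 (sub_add_cancel 1 t), mem_univ _⟩

end lineHomotopy

/-- With `Σ_n` acting by left multiplication on the `Σ_n` factor, the
inclusion `uD_ℝ(n) × Σ_n ↪ uD^c(n) × Σ_n` and the map `σ ↦ (((0,0),…,(0,0)), σ)` are
`Σ_n`-equivariant homotopy equivalences: each admits a continuous `Σ_n`-equivariant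
homotopy inverse, with homotopies all of whose time-slices are `Σ_n`-equivariant. -/
theorem stmt_11 (n : ℕ) (hn : 1 ≤ n) :
    -- the inclusion `uD_ℝ(n) × Σ_n ↪ uD^c(n) × Σ_n`
    (Set.MapsTo id (ADR n) (ADc n) ∧
      ∃ g : AD n → AD n, ∃ HR Hc : AD n × ℝ → AD n,
        Set.MapsTo g (ADc n) (ADR n) ∧ ContinuousOn g (ADc n) ∧
        (∀ ρ, ∀ y ∈ ADc n, g (permActAD n ρ y) = permActAD n ρ (g y)) ∧
        ContinuousOn HR ((ADR n) ×ˢ Icc (0 : ℝ) 1) ∧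
        (∀ t ∈ Icc (0 : ℝ) 1, ∀ y ∈ ADR n, HR (y, t) ∈ ADR n ∧
          ∀ ρ, HR (permActAD n ρ y, t) = permActAD n ρ (HR (y, t))) ∧
        (∀ y ∈ ADR n, HR (y, 0) = g y ∧ HR (y, 1) = y) ∧
        ContinuousOn Hc ((ADc n) ×ˢ Icc (0 : ℝ) 1) ∧
        (∀ t ∈ Icc (0 : ℝ) 1, ∀ y ∈ ADc n, Hc (y, t) ∈ ADc n ∧
          ∀ ρ, Hc (permActAD n ρ y, t) = permActAD n ρ (Hc (y, t))) ∧
        (∀ y ∈ ADc n, Hc (y, 0) = g y ∧ Hc (y, 1) = y)) ∧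
    -- the map `Σ_n → uD^c(n) × Σ_n`, `σ ↦ (((0,0),…,(0,0)), σ)`
    ((∀ σ, ptMap n σ ∈ ADc n) ∧ Continuous (ptMap n) ∧
      (∀ ρ σ, ptMap n (ρ * σ) = permActAD n ρ (ptMap n σ)) ∧
      ∃ g₂ : AD n → Equiv.Perm (Fin n), ∃ H₂ : AD n × ℝ → AD n,
        ContinuousOn g₂ (ADc n) ∧
        (∀ ρ, ∀ y ∈ ADc n, g₂ (permActAD n ρ y) = ρ * g₂ y) ∧
        (∀ σ, g₂ (ptMap n σ) = σ) ∧
        ContinuousOn H₂ ((ADc n) ×ˢ Icc (0 : ℝ) 1) ∧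
        (∀ t ∈ Icc (0 : ℝ) 1, ∀ y ∈ ADc n, H₂ (y, t) ∈ ADc n ∧
          ∀ ρ, H₂ (permActAD n ρ y, t) = permActAD n ρ (H₂ (y, t))) ∧
        (∀ y ∈ ADc n, H₂ (y, 0) = ptMap n (g₂ y) ∧ H₂ (y, 1) = y)) := by
  have hR := equalSubdivision_mem_uDR n
  have hc := uDR_subset_uDc n hR
  refine ⟨⟨fun y hy => ⟨uDR_subset_uDc n hy.1, mem_univ _⟩,
      fun y => (equalSubdivision n, y.2), lineHomotopy (equalSubdivision n),
      lineHomotopy (equalSubdivision n), fun _ _ => ⟨hR, mem_univ _⟩,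
      (continuous_const.prodMk continuous_snd).continuousOn, fun _ _ _ => rfl,
      (continuous_lineHomotopy _).continuousOn,
      fun t ht y hy => ⟨lineHomotopy_mem (convex_uDR n) hR hy ht,
        fun ρ => lineHomotopy_permActAD _ ρ y t⟩,
      fun y _ => ⟨lineHomotopy_zero _ y, lineHomotopy_one _ y⟩,
      (continuous_lineHomotopy _).continuousOn,
      fun t ht y hy => ⟨lineHomotopy_mem (convex_uDc n) hc hy ht,
        fun ρ => lineHomotopy_permActAD _ ρ y t⟩,
      fun y _ => ⟨lineHomotopy_zero _ y, lineHomotopy_one _ y⟩⟩,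
    fun _ => ⟨zero_mem_uDc n, mem_univ _⟩, continuous_const.prodMk continuous_id,
    fun _ _ => rfl, Prod.snd, lineHomotopy 0, continuous_snd.continuousOn, fun _ _ _ => rfl,
    fun _ => rfl, (continuous_lineHomotopy _).continuousOn,
    fun t ht y hy => ⟨lineHomotopy_mem (convex_uDc n) (zero_mem_uDc n) hy ht,
      fun ρ => lineHomotopy_permActAD _ ρ y t⟩,
    fun y _ => ⟨lineHomotopy_zero _ y, lineHomotopy_one _ y⟩⟩
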